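/- arXiv:1805.07135 — 2 statements merged into one kernel-verified Lean document; each statement's English description precedes it below -/
import Mathlib

section
/- Let n, k, s be real numbers with k ≥ 1, n ≥ 8, n/(k+1) ≤ s ≤ n·k/(k+1), and k·(k+1)·4·ln n ≤ n. Then, writing r = n − s + k, one has s·ln s + r·ln r ≤ n·ln n − n/(4·(k+1)). -/
/-- The tangent-line bound for `x log x`, obtained from `log y ≤ y - 1` at `y = x / n`. -/
theorem mul_log_le_mul_log_add {x n : ℝ} (hx : 0 < x) (hn : 0 < n) :
    x * Real.log x ≤ x * Real.log n + (x ^ 2 / n - x) := by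
  have h := mul_le_mul_of_nonneg_left (Real.log_le_sub_one_of_pos (div_pos hx hn)) hx.le
  rw [Real.log_div hx.ne' hn.ne'] at h
  have e : x * (x / n - 1) = x ^ 2 / n - x := by ring
  linarith

theorem stmt_12 (n k s : ℝ) (hk : 1 ≤ k) (hn : 8 ≤ n)
    (hs1 : n / (k + 1) ≤ s) (hs2 : s ≤ n * k / (k + 1))
    (hkn : k * (k + 1) * 4 * Real.log n ≤ n) :
    s * Real.log s + (n - s + k) * Real.log (n - s + k) ≤
      n * Real.log n - n / (4 * (k + 1)) := by
  have hn0 : 0 < n := by linarith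
  have hk1 : 0 < k + 1 := by linarith
  have hlog : 2 ≤ Real.log n := by
    have h8 : Real.log 8 = 3 * Real.log 2 := by
      rw [show (8 : ℝ) = 2 ^ 3 by norm_num, Real.log_pow]; norm_num
    have := Real.log_le_log (by norm_num) hn
    linarith [Real.log_two_gt_d9]
  obtain ⟨A, hA⟩ : ∃ A, A = n / (k + 1) := ⟨_, rfl⟩
  have hnA : n = (k + 1) * A := by rw [hA]; field_simp
  have hA0 : 0 < A := hA ▸ div_pos hn0 hk1
  have hsA : A ≤ s := hA ▸ hs1
  have hskA : s ≤ k * A := by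
    rwa [show n * k / (k + 1) = k * A by rw [hA]; ring] at hs2
  have hklog : 4 * (k * Real.log n) ≤ A := by
    rw [hA, le_div_iff₀ hk1]; linarith
  have hkA : 8 * k ≤ A := by nlinarith
  have hm : 0 < n - s := by linarith
  have hsq : s ^ 2 + (n - s + k) ^ 2 ≤ (n + k - A / 2) * n := by
    have hprod : k * A ^ 2 ≤ s * (n - s) := by
      rw [hnA]; nlinarith [mul_nonneg (sub_nonneg.2 hsA) (sub_nonneg.2 hskA)]
    have hnA2 : n * A ≤ 2 * (k * A ^ 2) := by
      rw [hnA]; nlinarith [mul_nonneg (sub_nonneg.2 hk) (sq_nonneg A)]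
    have hkn2 : 8 * k * n ≤ A * n := mul_le_mul_of_nonneg_right hkA hn0.le
    have hkk : k * k ≤ k * n := by gcongr; nlinarith
    have hks : 0 ≤ k * s := by nlinarith
    have hnA0 : 0 < n * A := mul_pos hn0 hA0
    linarith
  have hdiv : s ^ 2 / n + (n - s + k) ^ 2 / n ≤ n + k - A / 2 := by
    rw [← add_div, div_le_iff₀ hn0]; exact hsq
  have h1 := mul_log_le_mul_log_add (hA0.trans_le hsA) hn0
  have h2 := mul_log_le_mul_log_add (x := n - s + k) (by linarith) hn0
  have hgoal : n / (4 * (k + 1)) = A / 4 := by rw [hA]; field_simp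
  rw [hgoal]
  linarith
end

section
/- Let G be a connected simple graph on a finite vertex type V, let Y ⊆ V be a nonempty set of vertices, let x be a vertex, and let z : Fin k → V be an injective enumeration of a set Z of vertices with Z ⊆ Y, such that every walk in G from x to any vertex of Y contains some vertex z(i). Call a walk from x to a vertex y shortest if its length equals dist(x, y). For i : Fin k, define E(i) as the supremum (with supremum of the empty set equal to 0) of dist(z(i), y) over all y ∈ Y such that (a) some shortest walk from x to y contains z(i), and (b) no shortest walk from x to y contains any z(j) with j < i. Then the eccentricity of x toward Y satisfies: max over y ∈ Y of dist(x, y) = max over i : Fin k of (dist(x, z(i)) + E(i)). -/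
/-- A walk from `x` to `y` is *shortest* if its length equals the graph distance. -/
def IsShortestWalk {V : Type*} {G : SimpleGraph V} {x y : V} (w : G.Walk x y) : Prop :=
  w.length = G.dist x y

/-- The `z i`-visiting eccentricity of `x` toward `Y`: the supremum (0 for the empty set)
of `dist (z i) y` over `y ∈ Y` such that some shortest walk from `x` to `y` contains `z i`,
and no shortest walk from `x` to `y` contains any `z j` with `j < i`. -/
noncomputable def visitingEcc {V : Type*} (G : SimpleGraph V) (x : V) (Y : Finset V)
    {k : ℕ} (z : Fin k → V) (i : Fin k) : ℕ :=
  sSup {d : ℕ | ∃ y ∈ Y,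
    (∃ w : G.Walk x y, IsShortestWalk w ∧ z i ∈ w.support) ∧
    (∀ j : Fin k, j < i → ∀ w : G.Walk x y, IsShortestWalk w → z j ∉ w.support) ∧
    d = G.dist (z i) y}

theorem IsShortestWalk.dist_add_dist {V : Type*} {G : SimpleGraph V} {x y v : V}
    {w : G.Walk x y} (hw : IsShortestWalk w) (hG : G.Connected) (hv : v ∈ w.support) :
    G.dist x v + G.dist v y = G.dist x y := by
  classical
  refine le_antisymm ?_ hG.dist_triangle
  have hlen := congrArg SimpleGraph.Walk.length (w.take_spec hv)
  rw [SimpleGraph.Walk.length_append, hw] at hlen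
  have h₁ := SimpleGraph.dist_le (w.takeUntil v hv)
  have h₂ := SimpleGraph.dist_le (w.dropUntil v hv)
  omega

theorem bddAbove_visitingEcc {V : Type*} (G : SimpleGraph V) (x : V) (Y : Finset V)
    {k : ℕ} (z : Fin k → V) (i : Fin k) :
    BddAbove {d : ℕ | ∃ y ∈ Y,
      (∃ w : G.Walk x y, IsShortestWalk w ∧ z i ∈ w.support) ∧
      (∀ j : Fin k, j < i → ∀ w : G.Walk x y, IsShortestWalk w → z j ∉ w.support) ∧
      d = G.dist (z i) y} := by
  refine ⟨Y.sup (G.dist (z i)), ?_⟩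
  rintro d ⟨y, hy, -, -, rfl⟩
  exact Finset.le_sup hy

theorem stmt_19 {V : Type*} [Fintype V] (G : SimpleGraph V) (hG : G.Connected)
    (Y : Finset V) (hY : Y.Nonempty) (x : V) (k : ℕ) (z : Fin k → V)
    (hz : Function.Injective z) (hZY : ∀ i : Fin k, z i ∈ Y)
    (hsep : ∀ y ∈ Y, ∀ w : G.Walk x y, ∃ i : Fin k, z i ∈ w.support) :
    Y.sup (fun y => G.dist x y) =
      (Finset.univ : Finset (Fin k)).sup
        (fun i => G.dist x (z i) + visitingEcc G x Y z i) := by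
  apply le_antisymm
  · refine Finset.sup_le fun y hy => ?_
    have hex : ∃ i : Fin k, ∃ w : G.Walk x y, IsShortestWalk w ∧ z i ∈ w.support := by
      obtain ⟨w, hw⟩ := hG.exists_walk_length_eq_dist x y
      obtain ⟨i, hi⟩ := hsep y hy w
      exact ⟨i, w, hw, hi⟩
    obtain ⟨i, ⟨w, hw, hi⟩, hmin⟩ := wellFounded_lt.has_min
      {i : Fin k | ∃ w : G.Walk x y, IsShortestWalk w ∧ z i ∈ w.support} hex
    refine le_trans ?_ (Finset.le_sup (Finset.mem_univ i))
    rw [← hw.dist_add_dist hG hi]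
    refine Nat.add_le_add_left (le_csSup (bddAbove_visitingEcc G x Y z i) ?_) _
    exact ⟨y, hy, ⟨w, hw, hi⟩, fun j hj w' hw' hmem => hmin j ⟨w', hw', hmem⟩ hj, rfl⟩
  · refine Finset.sup_le fun i _ => ?_
    rcases Set.eq_empty_or_nonempty {d : ℕ | ∃ y ∈ Y,
      (∃ w : G.Walk x y, IsShortestWalk w ∧ z i ∈ w.support) ∧
      (∀ j : Fin k, j < i → ∀ w : G.Walk x y, IsShortestWalk w → z j ∉ w.support) ∧
      d = G.dist (z i) y} with hempty | hne
    · rw [visitingEcc, hempty, csSup_empty, bot_eq_zero, add_zero]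
      exact Finset.le_sup (f := fun y => G.dist x y) (hZY i)
    · obtain ⟨y, hy, ⟨w, hw, hi⟩, -, hd⟩ := Nat.sSup_mem hne (bddAbove_visitingEcc G x Y z i)
      rw [visitingEcc, hd, hw.dist_add_dist hG hi]
      exact Finset.le_sup (f := fun y => G.dist x y) hy
end
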